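/- arXiv:2002.05859 — 3 statements merged into one kernel-verified Lean document; each statement's English description precedes it below -/
import Mathlib

section
/- Let q be a prime power with q ≥ m, m ≥ 2, and n ≥ 2m−1. Let V be an n-dimensional vector space over 𝔽_q and let ℱ be an intersecting family of m-dimensional subspaces of V with covering number τ(ℱ) = m. Then |ℱ| ≤ [2m−1 over m]_q. -/
open Module

/-- The Gaussian binomial coefficient `[n over m]_q`, as a rational number. -/
def gaussBinom (q n m : ℕ) : ℚ :=
  ∏ i ∈ Finset.range m, ((q : ℚ) ^ (n - i) - 1) / ((q : ℚ) ^ (m - i) - 1)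

/-- A family of subspaces is intersecting if any two of its members have intersection
of dimension at least 1. -/
def IsIntersectingFamily {F V : Type*} [Field F] [AddCommGroup V] [Module F V]
    (𝒜 : Set (Submodule F V)) : Prop :=
  ∀ A ∈ 𝒜, ∀ B ∈ 𝒜, 1 ≤ finrank F ↥(A ⊓ B)

/-- The covering number of a family of subspaces: the minimum dimension of a subspace
intersecting every member of the family. -/
noncomputable def coveringNumber {F V : Type*} [Field F] [AddCommGroup V] [Module F V]
    (𝒜 : Set (Submodule F V)) : ℕ :=
  sInf { d : ℕ | ∃ W : Submodule F V, finrank F ↥W = d ∧ ∀ A ∈ 𝒜, 1 ≤ finrank F ↥(W ⊓ A) }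

theorem gaussBinom_eq_prod_sub {q n m : ℕ} (hq : 2 ≤ q) (hmn : m ≤ n) :
    gaussBinom q n m = (∏ i : Fin m, ((q : ℚ) ^ n - (q : ℚ) ^ (i : ℕ))) /
      ∏ i : Fin m, ((q : ℚ) ^ m - (q : ℚ) ^ (i : ℕ)) := by
  have hq0 : (q : ℚ) ≠ 0 := by positivity
  rw [gaussBinom, ← Finset.prod_div_distrib, Finset.prod_range]
  refine Finset.prod_congr rfl fun i _ => ?_
  have hi := i.isLt
  have h₁ : (q : ℚ) ^ n - (q : ℚ) ^ (i : ℕ) = (q : ℚ) ^ (i : ℕ) * ((q : ℚ) ^ (n - i) - 1) := by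
    rw [mul_sub, ← pow_add, mul_one, Nat.add_sub_cancel' (by omega)]
  have h₂ : (q : ℚ) ^ m - (q : ℚ) ^ (i : ℕ) = (q : ℚ) ^ (i : ℕ) * ((q : ℚ) ^ (m - i) - 1) := by
    rw [mul_sub, ← pow_add, mul_one, Nat.add_sub_cancel' (by omega)]
  rw [h₁, h₂, mul_div_mul_left _ _ (pow_ne_zero _ hq0)]

section Counting

variable {F V : Type*} [Field F] [Fintype F] [AddCommGroup V] [Module F V]
  [FiniteDimensional F V]

/-- The number of `k`-dimensional subspaces of a subspace `W` is at most a Gaussian binomial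
coefficient. -/
theorem ncard_le_gaussBinom (W : Submodule F V) {k : ℕ} (hk : k ≤ finrank F W)
    (𝒜 : Set (Submodule F V)) (h𝒜 : ∀ S ∈ 𝒜, S ≤ W ∧ finrank F S = k) :
    (𝒜.ncard : ℚ) ≤ gaussBinom (Fintype.card F) (finrank F W) k := by
  classical
  have : Finite V := Module.finite_of_finite F
  have : Fintype 𝒜 := Fintype.ofFinite _
  have hq : 1 < Fintype.card F := Fintype.one_lt_card
  let L (S : Submodule F V) := {s : Fin k → S // LinearIndependent F s}
  let f : (Σ S : 𝒜, L S) → L W := fun p =>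
    ⟨fun i => Submodule.inclusion (h𝒜 p.1 p.1.2).1 (p.2.1 i),
      p.2.2.map' _ (Submodule.ker_inclusion _ _ _)⟩
  have hspan (S : 𝒜) (s : L S) :
      Submodule.span F (Set.range fun i => (s.1 i : V)) = S := by
    refine Submodule.eq_of_le_of_finrank_eq ?_ ?_
    · rw [Submodule.span_le]
      rintro _ ⟨i, rfl⟩
      exact (s.1 i).2
    · have := finrank_span_eq_card (s.2.map' S.1.subtype (Submodule.ker_subtype _))
      rw [Fintype.card_fin] at this
      exact this.trans (h𝒜 S S.2).2.symm
  have hf : Function.Injective f := by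
    rintro ⟨S, s⟩ ⟨T, t⟩ h
    have hst : ∀ i, (s.1 i : V) = t.1 i := fun i =>
      congrArg (fun u : L W => (u.1 i : V)) h
    have hST : S = T := by
      apply Subtype.ext
      rw [← hspan S s, ← hspan T t]
      simp only [hst]
    subst hST
    congr 1
    exact Subtype.ext (funext fun i => Subtype.ext (hst i))
  have hcard (S : 𝒜) : Nat.card (L S) =
      ∏ i : Fin k, (Fintype.card F ^ k - Fintype.card F ^ (i : ℕ)) := by
    have h := (h𝒜 S S.2).2
    rw [card_linearIndependent h.ge, h]
  have key := Nat.card_le_card_of_injective f hf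
  rw [card_linearIndependent hk, Nat.card_sigma, Finset.sum_congr rfl fun S _ => hcard S,
    Finset.sum_const, Finset.card_univ, smul_eq_mul, ← Nat.card_eq_fintype_card,
    Nat.card_coe_set_eq] at key
  have hpos : 0 < ∏ i : Fin k, ((Fintype.card F : ℚ) ^ k - (Fintype.card F : ℚ) ^ (i : ℕ)) :=
    Finset.prod_pos fun i _ => sub_pos.2 (pow_lt_pow_right₀ (by exact_mod_cast hq) i.isLt)
  have cast_prod (n : ℕ) (hn : k ≤ n) :
      ((∏ i : Fin k, (Fintype.card F ^ n - Fintype.card F ^ (i : ℕ)) : ℕ) : ℚ) =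
        ∏ i : Fin k, ((Fintype.card F : ℚ) ^ n - (Fintype.card F : ℚ) ^ (i : ℕ)) := by
    rw [Nat.cast_prod]
    refine Finset.prod_congr rfl fun i _ => ?_
    rw [Nat.cast_sub (Nat.pow_le_pow_right hq.le (i.isLt.le.trans hn))]
    push_cast
    rfl
  rw [gaussBinom_eq_prod_sub hq hk, le_div_iff₀ hpos, ← cast_prod k le_rfl, ← cast_prod _ hk]
  exact_mod_cast key

/-- The number of `(k + 1)`-dimensional subspaces of `W` through a nonzero vector `x ∈ W` is at
most a Gaussian binomial coefficient. -/
theorem ncard_le_gaussBinom_of_mem (W : Submodule F V) {n k : ℕ} (hk : k ≤ n)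
    (hW : finrank F W = n + 1) {x : V} (hx : x ≠ 0) (hxW : x ∈ W) (𝒜 : Set (Submodule F V))
    (h𝒜 : ∀ S ∈ 𝒜, S ≤ W ∧ finrank F S = k + 1 ∧ x ∈ S) :
    (𝒜.ncard : ℚ) ≤ gaussBinom (Fintype.card F) n k := by
  set X := Submodule.span F {x}
  have hmap (S : Submodule F V) (hxS : x ∈ S) : finrank F (S.map X.mkQ) + 1 = finrank F S := by
    have hXS : X ≤ S := by simpa [X] using hxS
    have h := (X.mkQ.domRestrict S).finrank_range_add_finrank_ker
    rwa [LinearMap.range_domRestrict, LinearMap.ker_domRestrict, Submodule.ker_mkQ,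
      (Submodule.comapSubtypeEquivOfLe hXS).finrank_eq, finrank_span_singleton hx] at h
  have hinj : Set.InjOn (Submodule.map X.mkQ) 𝒜 := by
    intro S hS T hT h
    have hXS : X ≤ S := by simpa [X] using (h𝒜 S hS).2.2
    have hXT : X ≤ T := by simpa [X] using (h𝒜 T hT).2.2
    have := congrArg (Submodule.comap X.mkQ) h
    rwa [Submodule.comap_map_mkQ, Submodule.comap_map_mkQ, sup_eq_right.2 hXS,
      sup_eq_right.2 hXT] at this
  have hWn : finrank F (W.map X.mkQ) = n := by have := hmap W hxW; omega
  rw [← hinj.ncard_image, ← hWn]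
  refine ncard_le_gaussBinom _ (hWn ▸ hk) _ ?_
  rintro _ ⟨S, hS, rfl⟩
  obtain ⟨hSW, hSk, hxS⟩ := h𝒜 S hS
  exact ⟨Submodule.map_mono hSW, by have := hmap S hxS; omega⟩

/-- If every member of `𝒜` meets `D`, and every nonzero vector of `D` lies in at most `c` members
of `𝒜`, then `𝒜` has at most `[dim D] * c` members. -/
theorem ncard_le_geom_sum_mul (D : Submodule F V) {d : ℕ} (hd : finrank F D ≤ d) (c : ℚ)
    (hc : 0 ≤ c) (𝒜 : Set (Submodule F V)) (hD : ∀ S ∈ 𝒜, D ⊓ S ≠ ⊥)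
    (h : ∀ x ∈ D, x ≠ 0 → ({S ∈ 𝒜 | x ∈ S}.ncard : ℚ) ≤ c) :
    (𝒜.ncard : ℚ) ≤ (∑ i ∈ Finset.range d, (Fintype.card F : ℚ) ^ i) * c := by
  have : Finite V := Module.finite_of_finite F
  have : Fintype (Projectivization F D) := Fintype.ofFinite _
  have hsub : 𝒜 ⊆ ⋃ p : Projectivization F D, {S ∈ 𝒜 | (p.rep : V) ∈ S} := by
    intro S hS
    obtain ⟨x, ⟨hxD, hxS⟩, hx⟩ := Submodule.exists_mem_ne_zero_of_ne_bot (hD S hS)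
    have hx' : (⟨x, hxD⟩ : D) ≠ 0 := by simpa using hx
    refine Set.mem_iUnion.2 ⟨Projectivization.mk F ⟨x, hxD⟩ hx', hS, ?_⟩
    obtain ⟨a, ha⟩ := Projectivization.exists_smul_eq_mk_rep F _ hx'
    rw [← ha]
    exact S.smul_mem (a : F) hxS
  have hcard := Projectivization.card_of_finrank F D rfl
  calc (𝒜.ncard : ℚ)
      ≤ ∑ p : Projectivization F D, ({S ∈ 𝒜 | (p.rep : V) ∈ S}.ncard : ℚ) := by
        exact_mod_cast (Set.ncard_le_ncard hsub (Set.toFinite _)).trans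
          (Set.ncard_iUnion_le_of_fintype _)
    _ ≤ ∑ _p : Projectivization F D, c := Finset.sum_le_sum fun p _ =>
        h _ p.rep.2 (by simpa using p.rep_nonzero)
    _ = (∑ i ∈ Finset.range (finrank F D), (Fintype.card F : ℚ) ^ i) * c := by
        rw [Finset.sum_const, Finset.card_univ, ← Nat.card_eq_fintype_card, hcard, nsmul_eq_mul,
          Nat.card_eq_fintype_card]
        push_cast
        rfl
    _ ≤ _ := by
        gcongr

/-- If every subspace of dimension less than `k` is missed by some member of the intersecting
family `ℱ`, then the number of members containing a `(k - j)`-dimensional subspace is at most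
`[m] ^ j` times a bound for the number of members containing a `k`-dimensional subspace. -/
theorem ncard_superset_le {m k : ℕ} {ℱ : Set (Submodule F V)}
    (hdim : ∀ A ∈ ℱ, finrank F A = m) (hint : IsIntersectingFamily ℱ)
    (hcov : ∀ P : Submodule F V, finrank F P < k → ∃ G ∈ ℱ, P ⊓ G = ⊥) {c : ℚ} (hc : 0 ≤ c)
    (hk : ∀ P : Submodule F V, finrank F P = k → ({A ∈ ℱ | P ≤ A}.ncard : ℚ) ≤ c) (j : ℕ) :
    ∀ P : Submodule F V, finrank F P + j = k →
      ({A ∈ ℱ | P ≤ A}.ncard : ℚ) ≤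
        (∑ i ∈ Finset.range m, (Fintype.card F : ℚ) ^ i) ^ j * c := by
  induction j with
  | zero => intro P hP; simpa using hk P hP
  | succ j ih =>
    intro P hP
    obtain ⟨G, hG, hPG⟩ := hcov P (by omega)
    rw [pow_succ', mul_assoc]
    refine ncard_le_geom_sum_mul G (hdim G hG).le _ (by positivity) _
      (fun S hS h => ?_) fun x hxG hx => ?_
    · have := hint G hG S hS.1
      rw [h, finrank_bot] at this
      omega
    · have hdisj : P ⊓ F ∙ x = ⊥ :=
        eq_bot_iff.2 ((inf_le_inf_left P (by simpa using hxG)).trans hPG.le)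
      have hfin := Submodule.finrank_sup_add_finrank_inf_eq P (F ∙ x)
      rw [hdisj, finrank_bot, finrank_span_singleton hx] at hfin
      convert ih (P ⊔ F ∙ x) (by omega) using 4
      ext S
      simp [and_assoc]

/-- If `G₁` and `G₂` miss the `(m - 1)`-dimensional subspace `P` and have different sums with it,
then fewer than the maximal number of members contain `P`. -/
theorem ncard_superset_le_of_sup_ne {k : ℕ} {ℱ : Set (Submodule F V)}
    (hdim : ∀ A ∈ ℱ, finrank F A = k + 1) (hint : IsIntersectingFamily ℱ)
    {P G₁ G₂ : Submodule F V} (hP : finrank F P = k) (hG₁ : G₁ ∈ ℱ) (hG₂ : G₂ ∈ ℱ)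
    (h₁ : P ⊓ G₁ = ⊥) (h₂ : P ⊓ G₂ = ⊥) (hne : P ⊔ G₁ ≠ P ⊔ G₂) :
    ({A ∈ ℱ | P ≤ A}.ncard : ℚ) ≤ ∑ i ∈ Finset.range k, (Fintype.card F : ℚ) ^ i := by
  have hf₁ := Submodule.finrank_sup_add_finrank_inf_eq P G₁
  have hf₂ := Submodule.finrank_sup_add_finrank_inf_eq P G₂
  rw [h₁, finrank_bot, hP, hdim _ hG₁] at hf₁
  rw [h₂, finrank_bot, hP, hdim _ hG₂] at hf₂
  have hlt : G₁ ⊓ (P ⊔ G₂) < G₁ := by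
    refine inf_le_left.lt_of_ne fun h => hne ?_
    exact Submodule.eq_of_le_of_finrank_eq (sup_le le_sup_left (inf_eq_left.1 h)) (by omega)
  have hD := Submodule.finrank_lt_finrank_of_lt hlt
  rw [hdim _ hG₁] at hD
  have span_eq : ∀ S ∈ ℱ, P ≤ S → ∀ G ∈ ℱ, P ⊓ G = ⊥ → ∀ x ∈ G, x ≠ 0 → x ∈ S →
      P ⊔ F ∙ x = S := by
    intro S hS hPS G hG hPG x hxG hx hxS
    have hdisj : P ⊓ F ∙ x = ⊥ :=
      eq_bot_iff.2 ((inf_le_inf_left P (by simpa using hxG)).trans hPG.le)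
    have hfin := Submodule.finrank_sup_add_finrank_inf_eq P (F ∙ x)
    rw [hdisj, finrank_bot, finrank_span_singleton hx, hP] at hfin
    exact Submodule.eq_of_le_of_finrank_eq (sup_le hPS (by simpa using hxS))
      (by rw [hdim S hS]; omega)
  have hmeet : ∀ S ∈ ℱ, ∀ G ∈ ℱ, ∃ x ∈ G, x ≠ 0 ∧ x ∈ S := by
    intro S hS G hG
    have hne : G ⊓ S ≠ ⊥ := fun h => by
      have := hint G hG S hS
      rw [h, finrank_bot] at this
      omega
    obtain ⟨x, ⟨hxG, hxS⟩, hx⟩ := Submodule.exists_mem_ne_zero_of_ne_bot hne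
    exact ⟨x, hxG, hx, hxS⟩
  rw [← mul_one (∑ i ∈ Finset.range k, (Fintype.card F : ℚ) ^ i)]
  refine ncard_le_geom_sum_mul (G₁ ⊓ (P ⊔ G₂)) (by omega) 1 zero_le_one _ ?_ ?_
  · rintro S ⟨hS, hPS⟩ h
    obtain ⟨x, hxG, hx, hxS⟩ := hmeet S hS G₁ hG₁
    obtain ⟨y, hyG, hy, hyS⟩ := hmeet S hS G₂ hG₂
    have hSle : S ≤ P ⊔ G₂ := by
      rw [← span_eq S hS hPS G₂ hG₂ h₂ y hyG hy hyS]
      exact sup_le_sup_left (by simpa using hyG) P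
    have : x ∈ (⊥ : Submodule F V) := h ▸ ⟨⟨hxG, hSle hxS⟩, hxS⟩
    exact hx (by simpa using this)
  · rintro x ⟨hxG, -⟩ hx
    have : {S ∈ {A ∈ ℱ | P ≤ A} | x ∈ S} ⊆ {P ⊔ F ∙ x} := by
      rintro S ⟨⟨hS, hPS⟩, hxS⟩
      exact (span_eq S hS hPS G₁ hG₁ h₁ x hxG hx hxS).symm
    exact_mod_cast (Set.ncard_le_ncard this).trans (Set.ncard_singleton _).le

end Counting

section Estimate

theorem gaussBinom_succ_succ (q n k : ℕ) :
    gaussBinom q (n + 1) (k + 1) =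
      gaussBinom q n k * (((q : ℚ) ^ (n + 1) - 1) / ((q : ℚ) ^ (k + 1) - 1)) := by
  simp [gaussBinom, Finset.prod_range_succ', Nat.add_sub_add_right, mul_div_mul_comm]

theorem gaussBinom_nonneg {q : ℕ} (hq : 1 ≤ q) (n k : ℕ) : 0 ≤ gaussBinom q n k := by
  have hq' : (1 : ℚ) ≤ q := by exact_mod_cast hq
  exact Finset.prod_nonneg fun i _ =>
    div_nonneg (sub_nonneg.2 (one_le_pow₀ hq')) (sub_nonneg.2 (one_le_pow₀ hq'))

theorem geom_sum_pow_le_mul_gaussBinom {q : ℕ} (hq : 2 ≤ q) (l : ℕ) :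
    (∑ i ∈ Finset.range (l + 2), (q : ℚ) ^ i) ^ (l + 1) ≤
      ((q : ℚ) / (q - 1)) ^ l * gaussBinom q (2 * (l + 1)) (l + 1) := by
  have hq' : (1 : ℚ) < q := by exact_mod_cast hq
  have hq1 : (0 : ℚ) < q - 1 := sub_pos.2 hq'
  have hg : (∑ i ∈ Finset.range (l + 2), (q : ℚ) ^ i) = ((q : ℚ) ^ (l + 2) - 1) / (q - 1) :=
    geom_sum_eq hq'.ne' _
  have hg0 : 0 ≤ ∑ i ∈ Finset.range (l + 2), (q : ℚ) ^ i := by positivity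
  rw [gaussBinom, Finset.prod_range_succ, ← mul_assoc, pow_succ]
  refine mul_le_mul ?_ (le_of_eq ?_) hg0 ?_
  · calc (∑ i ∈ Finset.range (l + 2), (q : ℚ) ^ i) ^ l
        = ∏ _i ∈ Finset.range l, ∑ i ∈ Finset.range (l + 2), (q : ℚ) ^ i := by simp
      _ ≤ ∏ i ∈ Finset.range l, ((q : ℚ) / (q - 1)) *
            (((q : ℚ) ^ (2 * (l + 1) - i) - 1) / ((q : ℚ) ^ (l + 1 - i) - 1)) := by
          refine Finset.prod_le_prod (fun _ _ => hg0) fun i hi => ?_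
          have hi := Finset.mem_range.1 hi
          obtain ⟨j, rfl⟩ : ∃ j, l = i + j := ⟨l - i, by omega⟩
          rw [show 2 * (i + j + 1) - i = (i + j + 1) + (j + 1) by omega,
            show i + j + 1 - i = j + 1 by omega, hg, div_mul_div_comm,
            div_le_div_iff₀ hq1 (mul_pos hq1 (sub_pos.2 (one_lt_pow₀ hq' (by omega))))]
          have h₁ : (q : ℚ) ≤ (q : ℚ) ^ (j + 1) := le_self_pow₀ hq'.le (by omega)
          have h₂ : (1 : ℚ) ≤ (q : ℚ) ^ (i + j + 2) := one_le_pow₀ hq'.le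
          have h₃ : (q : ℚ) * (q : ℚ) ^ (i + j + 1 + (j + 1)) =
              (q : ℚ) ^ (i + j + 2) * (q : ℚ) ^ (j + 1) := by ring
          nlinarith
      _ = _ := by rw [Finset.prod_mul_distrib, Finset.prod_const, Finset.card_range]
  · rw [hg, show 2 * (l + 1) - l = l + 2 by omega, show l + 1 - l = 1 by omega, pow_one]
  · refine mul_nonneg (by positivity) (Finset.prod_nonneg fun i _ => ?_)
    exact div_nonneg (sub_nonneg.2 (one_le_pow₀ hq'.le)) (sub_nonneg.2 (one_le_pow₀ hq'.le))

theorem div_sub_one_pow_le {q l : ℕ} (hq : 4 ≤ q) (hl : l + 2 ≤ q) :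
    ((q : ℚ) / (q - 1)) ^ l ≤ q - 2 := by
  have hq' : (4 : ℚ) ≤ q := by exact_mod_cast hq
  have hl' : (l : ℚ) + 2 ≤ q := by exact_mod_cast hl
  have hB : 1 + (l : ℚ) * (-(1 / q)) ≤ (1 + -(1 / (q : ℚ))) ^ l :=
    one_add_mul_le_pow (by
      have : 1 / (q : ℚ) ≤ 1 := by rw [div_le_one (by linarith)]; linarith
      linarith) l
  have hinv : (q : ℚ) / (q - 1) = (1 + -(1 / (q : ℚ)))⁻¹ := by
    have h1 : 1 + -(1 / (q : ℚ)) = (q - 1) / q := by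
      have hq0 : (q : ℚ) ≠ 0 := by positivity
      field_simp
      ring
    rw [h1, inv_div]
  have h2 : 2 / (q : ℚ) ≤ 1 + (l : ℚ) * (-(1 / q)) := by
    have hq0 : (0 : ℚ) < q := by linarith
    rw [div_le_iff₀ hq0]
    field_simp
    linarith
  rw [hinv, inv_pow]
  calc ((1 + -(1 / (q : ℚ))) ^ l)⁻¹ ≤ (2 / (q : ℚ))⁻¹ :=
        inv_anti₀ (by positivity) (h2.trans hB)
    _ ≤ q - 2 := by rw [inv_div]; linarith

theorem geom_sum_mul_add_le_gaussBinom {q k : ℕ} (hk : 1 ≤ k) (hkq : k + 1 ≤ q) :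
    (∑ i ∈ Finset.range k, (q : ℚ) ^ i) *
      ((∑ i ∈ Finset.range (k + 1), (q : ℚ) ^ i) ^ k + gaussBinom q (2 * k) k) ≤
      gaussBinom q (2 * k + 1) (k + 1) := by
  obtain ⟨l, rfl⟩ : ∃ l, k = l + 1 := ⟨k - 1, by omega⟩
  by_cases hspecial : q = 2 ∨ (q = 3 ∧ l = 1)
  · rcases hspecial with rfl | ⟨rfl, rfl⟩
    · obtain rfl : l = 0 := by omega
      norm_num [gaussBinom, Finset.sum_range_succ, Finset.prod_range_succ]
    · norm_num [gaussBinom, Finset.sum_range_succ, Finset.prod_range_succ]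
  have hratio : ((q : ℚ) / (q - 1)) ^ l ≤ q - 2 := by
    rcases Nat.lt_or_ge q 4 with h | h
    · obtain rfl : q = 3 := by omega
      obtain rfl : l = 0 := by omega
      norm_num
    · exact div_sub_one_pow_le h (by omega)
  have hq' : (1 : ℚ) < q := by exact_mod_cast (by omega : 1 < q)
  set B := gaussBinom q (2 * (l + 1)) (l + 1)
  have hB0 : 0 ≤ B := gaussBinom_nonneg (by omega) _ _
  have hpow := (geom_sum_pow_le_mul_gaussBinom (by omega : 2 ≤ q) l).trans
    (mul_le_mul_of_nonneg_right hratio hB0)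
  have hgk : (∑ i ∈ Finset.range (l + 1), (q : ℚ) ^ i) * (q - 1) = (q : ℚ) ^ (l + 1) - 1 :=
    geom_sum_mul _ _
  have hlast : (q : ℚ) ^ (l + 1) ≤
      ((q : ℚ) ^ (2 * (l + 1) + 1) - 1) / ((q : ℚ) ^ (l + 1 + 1) - 1) := by
    rw [le_div_iff₀ (sub_pos.2 (one_lt_pow₀ hq' (by omega)))]
    have h₁ : (1 : ℚ) ≤ (q : ℚ) ^ (l + 1) := one_le_pow₀ hq'.le
    have h₂ : (q : ℚ) ^ (2 * (l + 1) + 1) = (q : ℚ) ^ (l + 1) * (q : ℚ) ^ (l + 1 + 1) := by ring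
    rw [h₂]
    linarith
  rw [gaussBinom_succ_succ]
  calc _ ≤ (∑ i ∈ Finset.range (l + 1), (q : ℚ) ^ i) * (((q : ℚ) - 2) * B + B) := by gcongr
    _ = B * ((q : ℚ) ^ (l + 1) - 1) := by rw [← hgk]; ring
    _ ≤ _ := mul_le_mul_of_nonneg_left (by linarith) hB0

end Estimate

theorem stmt0 {F V : Type*} [Field F] [Fintype F] [AddCommGroup V] [Module F V]
    [FiniteDimensional F V] {q m n : ℕ} (hq : Fintype.card F = q)
    (hqm : m ≤ q) (hm : 2 ≤ m) (hn : 2 * m - 1 ≤ n) (hV : finrank F V = n)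
    (ℱ : Set (Submodule F V)) (hdim : ∀ A ∈ ℱ, finrank F ↥A = m)
    (hint : IsIntersectingFamily ℱ) (hτ : coveringNumber ℱ = m) :
    (ℱ.ncard : ℚ) ≤ gaussBinom q (2 * m - 1) m := by
  subst hq
  obtain ⟨k, rfl⟩ : ∃ k, m = k + 1 := ⟨m - 1, by omega⟩
  have : Finite V := Module.finite_of_finite F
  have hcov (P : Submodule F V) (hP : finrank F P < k + 1) : ∃ G ∈ ℱ, P ⊓ G = ⊥ := by
    by_contra! h
    have : coveringNumber ℱ ≤ finrank F P :=
      Nat.sInf_le ⟨P, rfl, fun A hA => Submodule.one_le_finrank_iff.2 (h A hA)⟩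
    omega
  have hne {A B : Submodule F V} (hA : A ∈ ℱ) (hB : B ∈ ℱ) : A ⊓ B ≠ ⊥ :=
    Submodule.one_le_finrank_iff.1 (hint A hA B hB)
  have hest := geom_sum_mul_add_le_gaussBinom (by omega : 1 ≤ k) hqm
  have hB := gaussBinom_nonneg (by omega : 1 ≤ Fintype.card F) (2 * k) k
  set q := Fintype.card F
  have hg0 (d : ℕ) : 0 ≤ ∑ i ∈ Finset.range d, (q : ℚ) ^ i := by positivity
  rw [show 2 * (k + 1) - 1 = 2 * k + 1 by omega]
  by_cases hfull : ∃ P : Submodule F V, finrank F P = k ∧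
      ∀ G₁ ∈ ℱ, ∀ G₂ ∈ ℱ, P ⊓ G₁ = ⊥ → P ⊓ G₂ = ⊥ → P ⊔ G₁ = P ⊔ G₂
  · obtain ⟨P, hP, hPG⟩ := hfull
    obtain ⟨G, hG, hdisj⟩ := hcov P (by omega)
    have hW := Submodule.finrank_sup_add_finrank_inf_eq P G
    rw [hdisj, finrank_bot, hP, hdim G hG] at hW
    set W := P ⊔ G
    replace hW : finrank F W = 2 * k + 1 := by omega
    by_cases hall : ∀ A ∈ ℱ, A ≤ W
    · rw [← hW]
      exact ncard_le_gaussBinom W (by omega) ℱ fun A hA => ⟨hall A hA, hdim A hA⟩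
    · push Not at hall
      obtain ⟨A₀, hA₀, hA₀W⟩ := hall
      have hlt := Submodule.finrank_lt_finrank_of_lt
        (inf_le_left.lt_of_ne fun h => hA₀W (inf_eq_left.1 h) : A₀ ⊓ W < A₀)
      rw [hdim A₀ hA₀] at hlt
      have hin : ({A ∈ ℱ | A ≤ W}.ncard : ℚ) ≤
          (∑ i ∈ Finset.range k, (q : ℚ) ^ i) * gaussBinom q (2 * k) k := by
        refine ncard_le_geom_sum_mul (A₀ ⊓ W) (by omega) _ hB _ ?_ ?_
        · rintro S ⟨hS, hSW⟩
          rw [inf_assoc, inf_eq_right.2 hSW]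
          exact hne hA₀ hS
        · rintro x ⟨-, hxW⟩ hx
          exact ncard_le_gaussBinom_of_mem W (by omega) hW hx hxW _
            fun S hS => ⟨hS.1.2, hdim S hS.1.1, hS.2⟩
      have hout : ({A ∈ ℱ | ¬ A ≤ W}.ncard : ℚ) ≤
          (∑ i ∈ Finset.range k, (q : ℚ) ^ i) *
            (∑ i ∈ Finset.range (k + 1), (q : ℚ) ^ i) ^ k := by
        refine ncard_le_geom_sum_mul P hP.le _ (pow_nonneg (hg0 _) _) _ ?_ ?_
        · rintro S ⟨hS, hSW⟩ h
          exact hSW (le_sup_right.trans (hPG S hS G hG h hdisj).le)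
        · intro x _ hx
          have hbase (Q : Submodule F V) (hQ : finrank F Q = k + 1) :
              ({A ∈ ℱ | Q ≤ A}.ncard : ℚ) ≤ 1 := by
            have : {A ∈ ℱ | Q ≤ A} ⊆ {Q} := fun A hA =>
              (Submodule.eq_of_le_of_finrank_eq hA.2 (by rw [hQ, hdim A hA.1])).symm
            exact_mod_cast (Set.ncard_le_ncard this).trans (Set.ncard_singleton _).le
          have h := ncard_superset_le hdim hint hcov zero_le_one hbase k (F ∙ x)
            (by rw [finrank_span_singleton hx]; omega)
          rw [mul_one] at h
          refine le_trans ?_ h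
          have : {S ∈ {A ∈ ℱ | ¬ A ≤ W} | x ∈ S} ⊆ {A ∈ ℱ | F ∙ x ≤ A} := fun S hS =>
            ⟨hS.1.1, by simpa using hS.2⟩
          exact_mod_cast Set.ncard_le_ncard this
      have hunion : ℱ = {A ∈ ℱ | A ≤ W} ∪ {A ∈ ℱ | ¬ A ≤ W} := by
        ext A
        simp only [Set.mem_union, Set.mem_ofPred_eq]
        tauto
      have hcard : (ℱ.ncard : ℚ) ≤ {A ∈ ℱ | A ≤ W}.ncard + {A ∈ ℱ | ¬ A ≤ W}.ncard := by
        conv_lhs => rw [hunion]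
        exact_mod_cast Set.ncard_union_le _ _
      linarith
  · push Not at hfull
    have h := ncard_superset_le (k := k) hdim hint (fun P hP => hcov P (by omega)) (hg0 k)
      (fun P hP => by
        obtain ⟨G₁, hG₁, G₂, hG₂, h₁, h₂, hsup⟩ := hfull P hP
        exact ncard_superset_le_of_sup_ne hdim hint hP hG₁ hG₂ h₁ h₂ hsup)
      k ⊥ (by simp)
    have hbot : {A ∈ ℱ | ⊥ ≤ A} = ℱ := by simp
    rw [hbot] at h
    have := mul_nonneg (hg0 k) hB
    linarith
end

section
/- Let q be a prime power with q ≥ m, m ≥ 2, and n ≥ 2m−1. Let V be an n-dimensional vector space over 𝔽_q and let ℱ be an intersecting family of m-dimensional subspaces of V with covering number τ(ℱ) = m. Then |ℱ| = [2m−1 over m]_q if and only if there exists a (2m−1)-dimensional subspace X of V such that ℱ is the family of all m-dimensional subspaces of X. -/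
open Module

section Helpers

variable {F V : Type*} [Field F] [AddCommGroup V] [Module F V]
  [FiniteDimensional F V]

lemma finrank_sup_span_singleton_of_notMem {S : Submodule F V} {v : V} (hv : v ∉ S) :
    finrank F ↥(S ⊔ Submodule.span F {v}) = finrank F S + 1 := by
  have h0 : v ≠ 0 := fun h => hv (h ▸ S.zero_mem)
  have h1 : S ⊓ Submodule.span F {v} = ⊥ :=
    disjoint_iff.1 ((Submodule.disjoint_span_singleton' h0).2 hv)
  have h2 := Submodule.finrank_sup_add_finrank_inf_eq S (Submodule.span F {v})
  rw [h1, finrank_bot, finrank_span_singleton h0] at h2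
  exact h2

lemma exists_between_finrank_eq {T Y : Submodule F V} (hTY : T ≤ Y) {k : ℕ}
    (hT : finrank F T ≤ k) (hk : k ≤ finrank F Y) :
    ∃ T' : Submodule F V, T ≤ T' ∧ T' ≤ Y ∧ finrank F T' = k := by
  induction k, hT using Nat.le_induction with
  | base => exact ⟨T, le_rfl, hTY, rfl⟩
  | succ k _ ih =>
    obtain ⟨T', h1, h2, h3⟩ := ih (by omega)
    have hlt : T' < Y := lt_of_le_of_ne h2 (by rintro rfl; omega)
    obtain ⟨v, hvY, hv⟩ := SetLike.exists_of_lt hlt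
    exact ⟨T' ⊔ Submodule.span F {v}, h1.trans le_sup_left,
      sup_le h2 ((Submodule.span_singleton_le_iff_mem _ _).2 hvY),
      by rw [finrank_sup_span_singleton_of_notMem hv, h3]⟩

variable [Fintype F]

lemma ncard_submodule_diff_zero (U : Submodule F V) :
    ((U : Set V) \ {0}).ncard = Fintype.card F ^ finrank F U - 1 := by
  have : Finite V := Module.finite_of_finite F
  rw [Set.ncard_sdiff_singleton_of_mem U.zero_mem]
  congr 1
  have h := Module.natCard_eq_pow_finrank (K := F) (V := U)
  rw [Nat.card_eq_fintype_card (α := F)] at h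
  exact h

/-- Double counting of the pairs `(v, G)` with `v` a nonzero vector of `G ⊓ U`. -/
lemma card_sub_one_mul_ncard_le (𝒢 : Set (Submodule F V)) (U : Submodule F V) (B : ℕ)
    (h𝒢 : ∀ G ∈ 𝒢, G ⊓ U ≠ ⊥)
    (hB : ∀ v ∈ U, v ≠ 0 → {G ∈ 𝒢 | v ∈ G}.ncard ≤ B) :
    (Fintype.card F - 1) * 𝒢.ncard ≤ (Fintype.card F ^ finrank F U - 1) * B := by
  classical
  have : Finite V := Module.finite_of_finite F
  have f𝒢 : 𝒢.Finite := Set.toFinite _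
  have fU : ((U : Set V) \ {0}).Finite := Set.toFinite _
  have key := Finset.card_mul_le_card_mul (s := f𝒢.toFinset) (t := fU.toFinset)
    (m := Fintype.card F - 1) (n := B) (fun G v => v ∈ G) ?_ ?_
  · rw [← Set.ncard_eq_toFinset_card, ← Set.ncard_eq_toFinset_card,
      ncard_submodule_diff_zero] at key
    rwa [mul_comm]
  · intro G hG
    have hG := h𝒢 G (by simpa using hG)
    have h1 : 1 ≤ finrank F ↥(G ⊓ U) := Submodule.one_le_finrank_iff.2 hG
    have h2 : fU.toFinset.bipartiteAbove (fun G v => v ∈ G) G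
        = (Set.toFinite (((G ⊓ U : Submodule F V) : Set V) \ {0})).toFinset := by
      ext v
      simp [Finset.mem_bipartiteAbove]
      tauto
    rw [h2, ← Set.ncard_eq_toFinset_card, ncard_submodule_diff_zero]
    have h3 : Fintype.card F ^ 1 ≤ Fintype.card F ^ finrank F ↥(G ⊓ U) :=
      Nat.pow_le_pow_right Fintype.card_pos h1
    rw [pow_one] at h3
    omega
  · intro v hv
    have hv : v ∈ U ∧ v ≠ 0 := by simpa using hv
    have h2 : f𝒢.toFinset.bipartiteBelow (fun G v => v ∈ G) v
        = (Set.toFinite {G ∈ 𝒢 | v ∈ G}).toFinset := by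
      ext G
      simp [Finset.mem_bipartiteBelow]
    rw [h2, ← Set.ncard_eq_toFinset_card]
    exact hB v hv.1 hv.2

/-- The number of `m`-dimensional subspaces containing a given subspace, when every subspace of
dimension less than `m` misses some member of the family. -/
lemma pow_mul_ncard_le {m : ℕ} {ℱ : Set (Submodule F V)} (hdim : ∀ A ∈ ℱ, finrank F A = m)
    (hint : IsIntersectingFamily ℱ)
    (hcov : ∀ W : Submodule F V, finrank F W < m → ∃ A ∈ ℱ, W ⊓ A = ⊥)
    {d C : ℕ} (hd : d ≤ m)
    (hC : ∀ S : Submodule F V, finrank F S = d →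
      (Fintype.card F - 1) ^ (m - d) * {G ∈ ℱ | S ≤ G}.ncard ≤ C)
    (j : ℕ) (hj : j ≤ d) (S : Submodule F V) (hS : finrank F S = d - j) :
    (Fintype.card F - 1) ^ (m - d + j) * {G ∈ ℱ | S ≤ G}.ncard
      ≤ (Fintype.card F ^ m - 1) ^ j * C := by
  induction j generalizing S with
  | zero => simpa using hC S (by simpa using hS)
  | succ j ih =>
    obtain ⟨A, hA, hSA⟩ := hcov S (by omega)
    set P := (Fintype.card F - 1) ^ (m - d + j) with hP
    have hPpos : 0 < P := by
      have := Fintype.one_lt_card (α := F)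
      exact pow_pos (by omega) _
    have h := card_sub_one_mul_ncard_le {G ∈ ℱ | S ≤ G} A
      ((Fintype.card F ^ m - 1) ^ j * C / P) ?_ ?_
    · rw [hdim A hA] at h
      calc (Fintype.card F - 1) ^ (m - d + (j + 1)) * {G ∈ ℱ | S ≤ G}.ncard
          = P * ((Fintype.card F - 1) * {G ∈ ℱ | S ≤ G}.ncard) := by
            rw [← add_assoc, pow_succ, hP]; ring
        _ ≤ P * ((Fintype.card F ^ m - 1) * ((Fintype.card F ^ m - 1) ^ j * C / P)) := by
            gcongr
        _ = (Fintype.card F ^ m - 1) * (P * ((Fintype.card F ^ m - 1) ^ j * C / P)) := by ring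
        _ ≤ (Fintype.card F ^ m - 1) * ((Fintype.card F ^ m - 1) ^ j * C) := by
            exact Nat.mul_le_mul_left _ (Nat.mul_div_le _ _)
        _ = _ := by ring
    · intro G hG
      exact Submodule.one_le_finrank_iff.1 (hint G hG.1 A hA)
    · intro v hv hv0
      rw [Nat.le_div_iff_mul_le hPpos, mul_comm]
      have hvS : v ∉ S := fun hvS => hv0 (by
        have : v ∈ S ⊓ A := ⟨hvS, hv⟩
        simpa [hSA] using this)
      have := ih (by omega) (S ⊔ Submodule.span F {v})
        (by rw [finrank_sup_span_singleton_of_notMem hvS]; omega)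
      have he : {G ∈ {G ∈ ℱ | S ≤ G} | v ∈ G}
          = {G ∈ ℱ | S ⊔ Submodule.span F {v} ≤ G} := by
        ext G
        simp [and_assoc]
      rw [he]
      exact this

lemma ncard_le_one_of_finrank_eq {m : ℕ} {ℱ : Set (Submodule F V)}
    (hdim : ∀ A ∈ ℱ, finrank F A = m) (S : Submodule F V) (hS : finrank F S = m) :
    {G ∈ ℱ | S ≤ G}.ncard ≤ 1 := by
  have : Finite V := Module.finite_of_finite F
  rw [Set.ncard_le_one_iff]
  intro a b ha hb
  rw [← Submodule.eq_of_le_of_finrank_eq ha.2 (by rw [hS, hdim a ha.1]),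
    ← Submodule.eq_of_le_of_finrank_eq hb.2 (by rw [hS, hdim b hb.1])]

/-- A hyperplane `S` of members of the family lies in few of them if the members disjoint from `S`
are not all contained in a common subspace `S ⊔ A`. -/
lemma card_sub_one_mul_ncard_le_of_not_le {m : ℕ} (hm : 1 ≤ m) {ℱ : Set (Submodule F V)}
    (hdim : ∀ A ∈ ℱ, finrank F A = m) (hint : IsIntersectingFamily ℱ)
    {S A A' : Submodule F V} (hS : finrank F S = m - 1) (hA : A ∈ ℱ) (hA' : A' ∈ ℱ)
    (hSA : S ⊓ A = ⊥) (hSA' : S ⊓ A' = ⊥) (hle : ¬ A' ≤ S ⊔ A) :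
    (Fintype.card F - 1) * {G ∈ ℱ | S ≤ G}.ncard ≤ Fintype.card F ^ (m - 1) - 1 := by
  set U := A ⊓ (S ⊔ A') with hU
  have hUlt : finrank F U ≤ m - 1 := by
    have h1 : U ≤ A := inf_le_left
    have h2 : U ≠ A := by
      intro h
      have h3 : A ≤ S ⊔ A' := inf_eq_left.1 h
      have e1 := Submodule.finrank_sup_add_finrank_inf_eq S A
      have e2 := Submodule.finrank_sup_add_finrank_inf_eq S A'
      rw [hSA, finrank_bot, hdim A hA] at e1
      rw [hSA', finrank_bot, hdim A' hA'] at e2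
      have := Submodule.eq_of_le_of_finrank_eq (sup_le le_sup_left h3) (by omega)
      exact hle (this ▸ le_sup_right)
    have := Submodule.finrank_lt_finrank_of_lt (lt_of_le_of_ne h1 h2)
    rw [hdim A hA] at this
    omega
  have key := card_sub_one_mul_ncard_le {G ∈ ℱ | S ≤ G} U 1 ?_ ?_
  · rw [mul_one] at key
    refine key.trans (Nat.sub_le_sub_right ?_ 1)
    exact Nat.pow_le_pow_right Fintype.card_pos hUlt
  · rintro G ⟨hG, hSG⟩
    have h1 : G ⊓ A ≠ ⊥ := Submodule.one_le_finrank_iff.1 (hint G hG A hA)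
    have h2 : G ≤ S ⊔ A' := by
      obtain ⟨v, hv, hv0⟩ := Submodule.exists_mem_ne_zero_of_ne_bot
        (Submodule.one_le_finrank_iff.1 (hint G hG A' hA'))
      have hvS : v ∉ S := fun hvS => hv0 (by
        have : v ∈ S ⊓ A' := ⟨hvS, hv.2⟩
        simpa [hSA'] using this)
      have h3 : S ⊔ Submodule.span F {v} ≤ G :=
        sup_le hSG ((Submodule.span_singleton_le_iff_mem _ _).2 hv.1)
      have h4 := Submodule.eq_of_le_of_finrank_eq h3
        (by rw [finrank_sup_span_singleton_of_notMem hvS, hdim G hG]; omega)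
      rw [← h4]
      exact sup_le_sup_left ((Submodule.span_singleton_le_iff_mem _ _).2 hv.2) _
    have h5 : G ⊓ U = G ⊓ A := by
      rw [hU, inf_left_comm, inf_eq_left.2 h2, inf_comm]
    rwa [h5]
  · intro v hv hv0
    have hvS : v ∉ S := fun hvS => hv0 (by
      have : v ∈ S ⊓ A := ⟨hvS, hv.1⟩
      simpa [hSA] using this)
    have he : {G ∈ {G ∈ ℱ | S ≤ G} | v ∈ G}
        = {G ∈ ℱ | S ⊔ Submodule.span F {v} ≤ G} := by
      ext G
      simp [and_assoc]
    rw [he]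
    exact ncard_le_one_of_finrank_eq hdim _
      (by rw [finrank_sup_span_singleton_of_notMem hvS]; omega)

lemma card_pow_le_ncard_inf_eq_bot {m : ℕ} (hm : 1 ≤ m) {T Y : Submodule F V}
    (hY : finrank F Y = 2 * m - 1) (hTY : T ≤ Y) (hT : finrank F T ≤ m - 1) :
    Fintype.card F ^ (m * (m - 1))
      ≤ {G : Submodule F V | (finrank F G = m ∧ G ≤ Y) ∧ G ⊓ T = ⊥}.ncard := by
  have : Finite V := Module.finite_of_finite F
  obtain ⟨T', hTT', hT'Y, hT'⟩ := exists_between_finrank_eq hTY hT (by omega)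
  obtain ⟨C, hC1, hC2⟩ := IsModularLattice.exists_disjoint_and_sup_eq hT'Y
  have hCd : finrank F C = m := by
    have := Submodule.finrank_sup_add_finrank_inf_eq T' C
    rw [hC2, disjoint_iff.1 hC1, finrank_bot] at this
    omega
  have hCY : C ≤ Y := hC2 ▸ le_sup_right
  have hCT : ∀ x ∈ C, x ∈ T' → x = 0 := fun x hx hx' =>
    Submodule.disjoint_def.1 hC1 x hx' hx
  have hcard : Nat.card (C →ₗ[F] T') = Fintype.card F ^ (m * (m - 1)) := by
    rw [Module.natCard_eq_pow_finrank (K := F), Module.finrank_linearMap, hCd, hT',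
      Nat.card_eq_fintype_card]
  let φ : (C →ₗ[F] T') → (C →ₗ[F] V) := fun f => C.subtype + T'.subtype ∘ₗ f
  have hφ : ∀ f c, φ f c = (c : V) + (f c : V) := fun f c => rfl
  have hz : ∀ f c, φ f c ∈ T' → c = 0 := by
    intro f c h
    rw [hφ, Submodule.add_mem_iff_left _ (f c).2] at h
    exact Subtype.ext (hCT _ c.2 h)
  rw [← hcard, ← Set.ncard_univ]
  refine Set.ncard_le_ncard_of_injOn (fun f => LinearMap.range (φ f)) ?_ ?_ (Set.toFinite _)
  · intro f _
    refine ⟨⟨?_, ?_⟩, ?_⟩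
    · rw [LinearMap.finrank_range_of_inj, hCd]
      rw [← LinearMap.ker_eq_bot, LinearMap.ker_eq_bot']
      intro c hc
      exact hz f c (hc ▸ T'.zero_mem)
    · rintro _ ⟨c, rfl⟩
      rw [hφ]
      exact Y.add_mem (hCY c.2) (hT'Y (f c).2)
    · rw [eq_bot_iff]
      rintro _ ⟨⟨c, rfl⟩, hc⟩
      rw [hz f c (hTT' hc)]
      simp
  · intro f _ g _ hfg
    replace hfg : LinearMap.range (φ f) = LinearMap.range (φ g) := hfg
    ext c
    have h1 : φ f c ∈ LinearMap.range (φ g) := by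
      have : φ f c ∈ LinearMap.range (φ f) := ⟨c, rfl⟩
      rwa [hfg] at this
    obtain ⟨c', hc'⟩ := h1
    rw [hφ, hφ] at hc'
    have h2 : (c' : V) - c = f c - g c' := by
      rw [sub_eq_sub_iff_add_eq_add, hc', add_comm]
    have h3 : (c' : V) - c = 0 := hCT _ (C.sub_mem c'.2 c.2)
      (h2 ▸ T'.sub_mem (f c).2 (g c').2)
    have h4 : c' = c := Subtype.ext (sub_eq_zero.1 h3)
    subst h4
    exact (add_left_cancel hc').symm

lemma ncard_mul_prod_eq {m : ℕ} (Y : Submodule F V) (hY : m ≤ finrank F Y) :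
    {G : Submodule F V | finrank F G = m ∧ G ≤ Y}.ncard
        * ∏ i : Fin m, (Fintype.card F ^ m - Fintype.card F ^ i.val)
      = ∏ i : Fin m, (Fintype.card F ^ finrank F Y - Fintype.card F ^ i.val) := by
  have : Finite V := Module.finite_of_finite F
  let 𝒢 := {G : Submodule F V // finrank F G = m ∧ G ≤ Y}
  have : Fintype 𝒢 := Fintype.ofFinite _
  let e : (Σ G : 𝒢, {t : Fin m → G.1 // LinearIndependent F t}) →
      {s : Fin m → Y // LinearIndependent F s} := fun x =>
    ⟨Submodule.inclusion x.1.2.2 ∘ x.2.1,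
      x.2.2.map' _ (Submodule.ker_inclusion _ _ _)⟩
  have hspan : ∀ x : (Σ G : 𝒢, {t : Fin m → G.1 // LinearIndependent F t}),
      Submodule.span F (Set.range fun i => ((e x).1 i : V)) = x.1.1 := by
    rintro ⟨⟨G, hG, hGY⟩, t, ht⟩
    refine Submodule.eq_of_le_of_finrank_eq ?_ ?_
    · rw [Submodule.span_le]
      rintro _ ⟨i, rfl⟩
      exact (t i).2
    · have : LinearIndependent F fun i => (t i : V) := ht.map' G.subtype (Submodule.ker_subtype _)
      have h := finrank_span_eq_card this
      rw [Fintype.card_fin] at h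
      exact h.trans hG.symm
  have hbij : Function.Bijective e := by
    constructor
    · intro x y hxy
      have hG : x.1 = y.1 := by
        apply Subtype.ext
        rw [← hspan x, ← hspan y, hxy]
      obtain ⟨G, t, ht⟩ := x
      obtain ⟨G', t', ht'⟩ := y
      obtain rfl : G = G' := hG
      have : t = t' := by
        funext i
        have := congrArg (fun z => ((z.1 i : Y) : V)) hxy
        exact Subtype.ext this
      subst this
      rfl
    · rintro ⟨s, hs⟩
      have hs' : LinearIndependent F fun i => (s i : V) :=
        hs.map' Y.subtype (Submodule.ker_subtype _)
      refine ⟨⟨⟨Submodule.span F (Set.range fun i => (s i : V)), ?_, ?_⟩,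
        fun i => ⟨s i, Submodule.subset_span ⟨i, rfl⟩⟩, ?_⟩, ?_⟩
      · rw [finrank_span_eq_card hs', Fintype.card_fin]
      · rw [Submodule.span_le]
        rintro _ ⟨i, rfl⟩
        exact (s i).2
      · exact LinearIndependent.of_comp (Submodule.subtype _) hs'
      · rfl
  have h1 := Nat.card_eq_of_bijective e hbij
  rw [card_linearIndependent hY, Nat.card_sigma] at h1
  rw [← h1]
  have h2 : ∀ G : 𝒢, Nat.card {t : Fin m → G.1 // LinearIndependent F t}
      = ∏ i : Fin m, (Fintype.card F ^ m - Fintype.card F ^ i.val) := by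
    intro G
    rw [card_linearIndependent G.2.1.ge, G.2.1]
  rw [Finset.sum_congr rfl fun G _ => h2 G, Finset.sum_const, smul_eq_mul, Finset.card_univ,
    ← Nat.card_eq_fintype_card (α := 𝒢)]
  rfl

lemma ncard_eq_gaussBinom {m : ℕ} (Y : Submodule F V) (hY : m ≤ finrank F Y) :
    ({G : Submodule F V | finrank F G = m ∧ G ≤ Y}.ncard : ℚ)
      = gaussBinom (Fintype.card F) (finrank F Y) m := by
  have h := congrArg (Nat.cast : ℕ → ℚ) (ncard_mul_prod_eq Y hY)
  set q := Fintype.card F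
  have hq : 1 < q := Fintype.one_lt_card
  have hq' : (1 : ℚ) < q := by exact_mod_cast hq
  have hf : ∀ k, m ≤ k → ((∏ i : Fin m, (q ^ k - q ^ i.val) : ℕ) : ℚ)
      = (∏ i ∈ Finset.range m, (q : ℚ) ^ i) * ∏ i ∈ Finset.range m, ((q : ℚ) ^ (k - i) - 1) := by
    intro k hk
    rw [Fin.prod_univ_eq_prod_range (fun i => q ^ k - q ^ i) m, ← Finset.prod_mul_distrib,
      Nat.cast_prod]
    refine Finset.prod_congr rfl fun i hi => ?_
    have hi := Finset.mem_range.1 hi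
    rw [Nat.cast_sub (Nat.pow_le_pow_right hq.le (by omega)), mul_sub, ← pow_add]
    push_cast
    rw [mul_one, Nat.add_sub_cancel' (by omega)]
  rw [Nat.cast_mul, hf m le_rfl, hf _ hY] at h
  have h1 : (∏ i ∈ Finset.range m, (q : ℚ) ^ i) ≠ 0 :=
    Finset.prod_ne_zero_iff.2 fun i _ => pow_ne_zero _ (by positivity)
  have h2 : (∏ i ∈ Finset.range m, ((q : ℚ) ^ (m - i) - 1)) ≠ 0 := by
    refine Finset.prod_ne_zero_iff.2 fun i hi => ?_
    have hi := Finset.mem_range.1 hi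
    exact (sub_pos.2 (one_lt_pow₀ hq' (by omega))).ne'
  rw [gaussBinom, Finset.prod_div_distrib, eq_div_iff h2]
  apply mul_left_cancel₀ h1
  rw [← h]
  ring

end Helpers

lemma succ_pow_le_pow_succ {n k : ℕ} (hn : 3 ≤ n) (hk : k ≤ n) : (n + 1) ^ k ≤ n ^ (k + 1) := by
  have hn0 : (0 : ℝ) < n := by positivity
  have h1 : (1 + 1 / (n : ℝ)) ^ k ≤ n := by
    calc (1 + 1 / (n : ℝ)) ^ k ≤ Real.exp (1 / n) ^ k := by
          gcongr
          rw [add_comm]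
          exact Real.add_one_le_exp _
      _ = Real.exp (k * (1 / n)) := by rw [← Real.exp_nat_mul]
      _ ≤ Real.exp 1 := by
          gcongr
          rw [mul_one_div, div_le_one hn0]
          exact_mod_cast hk
      _ ≤ 3 := by linarith [Real.exp_one_lt_d9]
      _ ≤ n := by exact_mod_cast hn
  have h2 : ((n : ℝ) + 1) ^ k ≤ (n : ℝ) ^ (k + 1) := by
    have : (n : ℝ) + 1 = n * (1 + 1 / n) := by field_simp
    rw [this, mul_pow, pow_succ]
    gcongr
  exact_mod_cast h2

lemma pow_sub_one_mul_lt {q m : ℕ} (hm : 2 ≤ m) (hqm : m ≤ q) :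
    (q ^ m - 1) ^ (m - 1) * (q ^ (m - 1) - 1) < q ^ (m * (m - 1)) * (q - 1) ^ m := by
  rcases Nat.lt_or_ge q 4 with hq | hq
  · interval_cases q <;> interval_cases m <;> norm_num
  · have h1 : q ^ (m - 1) ≤ (q - 1) ^ m := by
      have := succ_pow_le_pow_succ (n := q - 1) (k := m - 1) (by omega) (by omega)
      rwa [Nat.sub_add_cancel (by omega), Nat.sub_add_cancel (by omega)] at this
    calc (q ^ m - 1) ^ (m - 1) * (q ^ (m - 1) - 1)
        ≤ (q ^ m) ^ (m - 1) * (q ^ (m - 1) - 1) := by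
          gcongr
          exact Nat.sub_le _ _
      _ < (q ^ m) ^ (m - 1) * q ^ (m - 1) := by
          have : 0 < q ^ (m - 1) := by positivity
          gcongr
          omega
      _ ≤ (q ^ m) ^ (m - 1) * (q - 1) ^ m := by gcongr
      _ = _ := by rw [← pow_mul]

/-- An intersecting family of `m`-dimensional subspaces with covering number `m` is either
contained in a `(2 * m - 1)`-dimensional subspace or small. -/
lemma forall_le_or_ncard_lt {F V : Type*} [Field F] [Fintype F] [AddCommGroup V] [Module F V]
    [FiniteDimensional F V] {m : ℕ} (hqm : m ≤ Fintype.card F) (hm : 2 ≤ m)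
    (hn : 2 * m - 1 ≤ finrank F V) {ℱ : Set (Submodule F V)}
    (hdim : ∀ A ∈ ℱ, finrank F A = m) (hint : IsIntersectingFamily ℱ)
    (hcov : ∀ W : Submodule F V, finrank F W < m → ∃ A ∈ ℱ, W ⊓ A = ⊥) :
    ∃ Y : Submodule F V, finrank F Y = 2 * m - 1 ∧ ((∀ A ∈ ℱ, A ≤ Y) ∨
      ℱ.ncard < {G : Submodule F V | finrank F G = m ∧ G ≤ Y}.ncard) := by
  have : Finite V := Module.finite_of_finite F
  have hineq := pow_sub_one_mul_lt hm hqm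
  have hq : 1 < Fintype.card F := Fintype.one_lt_card
  set q := Fintype.card F with hqdef
  by_cases hfull : ∃ S A : Submodule F V, finrank F S = m - 1 ∧ A ∈ ℱ ∧ S ⊓ A = ⊥ ∧
      ∀ A' ∈ ℱ, S ⊓ A' = ⊥ → A' ≤ S ⊔ A
  · obtain ⟨S, A, hS, hA, hSA, hall⟩ := hfull
    have hY : finrank F ↥(S ⊔ A) = 2 * m - 1 := by
      have := Submodule.finrank_sup_add_finrank_inf_eq S A
      rw [hSA, finrank_bot, hdim A hA] at this
      omega
    refine ⟨S ⊔ A, hY, ?_⟩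
    set Y := S ⊔ A
    by_cases hD : ∀ D ∈ ℱ, D ≤ Y
    · exact Or.inl hD
    right
    push Not at hD
    obtain ⟨D, hDℱ, hDY⟩ := hD
    have hT : finrank F ↥(D ⊓ Y) ≤ m - 1 := by
      have : D ⊓ Y < D := lt_of_le_of_ne inf_le_left fun h => hDY (inf_eq_left.1 h)
      have := Submodule.finrank_lt_finrank_of_lt this
      rw [hdim D hDℱ] at this
      omega
    have hlow := card_pow_le_ncard_inf_eq_bot (by omega) hY inf_le_right hT
    rw [← hqdef] at hlow
    have hout : {G ∈ ℱ | ¬ G ≤ Y}.ncard < q ^ (m * (m - 1)) := by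
      have hdeg := pow_mul_ncard_le hdim hint hcov (d := m) (C := 1) le_rfl
        (fun S hS => by simpa using ncard_le_one_of_finrank_eq hdim S hS) (m - 1) (by omega)
      simp only [Nat.sub_self, zero_add, mul_one] at hdeg
      rw [← hqdef] at hdeg
      have hPpos : 0 < (q - 1) ^ (m - 1) := pow_pos (by omega) _
      have key := card_sub_one_mul_ncard_le {G ∈ ℱ | ¬ G ≤ Y} S
        ((q ^ m - 1) ^ (m - 1) / (q - 1) ^ (m - 1)) ?_ ?_
      · rw [hS, ← hqdef] at key
        refine lt_of_mul_lt_mul_right (lt_of_le_of_lt ?_ hineq) (Nat.zero_le _)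
        calc {G ∈ ℱ | ¬ G ≤ Y}.ncard * (q - 1) ^ m
            = (q - 1) ^ (m - 1) * ((q - 1) * {G ∈ ℱ | ¬ G ≤ Y}.ncard) := by
              obtain ⟨k, rfl⟩ : ∃ k, m = k + 1 := ⟨m - 1, by omega⟩
              rw [pow_succ, Nat.add_sub_cancel]
              ring
          _ ≤ (q - 1) ^ (m - 1) *
              ((q ^ (m - 1) - 1) * ((q ^ m - 1) ^ (m - 1) / (q - 1) ^ (m - 1))) := by gcongr
          _ = (q - 1) ^ (m - 1) * ((q ^ m - 1) ^ (m - 1) / (q - 1) ^ (m - 1))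
              * (q ^ (m - 1) - 1) := by ring
          _ ≤ _ := by
              gcongr
              exact Nat.mul_div_le _ _
      · rintro G ⟨hG, hGY⟩ h
        exact hGY (hall G hG (by rw [inf_comm, h]))
      · intro v hv hv0
        rw [Nat.le_div_iff_mul_le hPpos, mul_comm]
        refine le_trans ?_ (hdeg (Submodule.span F {v})
          (by rw [finrank_span_singleton hv0]; omega))
        refine Nat.mul_le_mul_left _ (Set.ncard_le_ncard ?_ (Set.toFinite _))
        rintro G ⟨hG, hvG⟩
        exact ⟨hG.1, (Submodule.span_singleton_le_iff_mem _ _).2 hvG⟩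
    have hsub : ℱ ⊆ {G : Submodule F V | finrank F G = m ∧ G ≤ Y} \
        {G : Submodule F V | (finrank F G = m ∧ G ≤ Y) ∧ G ⊓ (D ⊓ Y) = ⊥} ∪
        {G ∈ ℱ | ¬ G ≤ Y} := by
      intro G hG
      by_cases hGY : G ≤ Y
      · refine Or.inl ⟨⟨hdim G hG, hGY⟩, fun h => ?_⟩
        refine Submodule.one_le_finrank_iff.1 (hint G hG D hDℱ) ?_
        rw [← h.2, inf_left_comm, inf_eq_left.2 hGY, inf_comm]
      · exact Or.inr ⟨hG, hGY⟩
    have h1 := (Set.ncard_le_ncard hsub (Set.toFinite _)).trans (Set.ncard_union_le _ _)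
    have h2 := Set.ncard_sdiff_add_ncard_of_subset
      (s := {G : Submodule F V | (finrank F G = m ∧ G ≤ Y) ∧ G ⊓ (D ⊓ Y) = ⊥})
      (t := {G : Submodule F V | finrank F G = m ∧ G ≤ Y}) (fun G hG => hG.1) (Set.toFinite _)
    omega
  · push Not at hfull
    obtain ⟨Y, -, -, hY⟩ := exists_between_finrank_eq (F := F) (V := V) (T := ⊥) (Y := ⊤)
      (k := 2 * m - 1) bot_le (by simp) (by rwa [finrank_top])
    refine ⟨Y, hY, Or.inr ?_⟩
    have hlow := card_pow_le_ncard_inf_eq_bot (T := ⊥) (by omega) hY bot_le (by simp)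
    simp only [inf_bot_eq, and_true] at hlow
    refine lt_of_lt_of_le ?_ hlow
    have key := pow_mul_ncard_le hdim hint hcov (d := m - 1) (C := q ^ (m - 1) - 1) (by omega)
      (fun S hS => by
        obtain ⟨A, hA, hSA⟩ := hcov S (by omega)
        obtain ⟨A', hA', hSA', hle⟩ := hfull S A hS hA hSA
        have := card_sub_one_mul_ncard_le_of_not_le (by omega) hdim hint hS hA hA' hSA hSA' hle
        rwa [show m - (m - 1) = 1 by omega, pow_one]) (m - 1) le_rfl ⊥ (by simp)
    rw [show m - (m - 1) + (m - 1) = m by omega, ← hqdef] at key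
    simp only [bot_le, and_true, Set.ofPred_mem_eq] at key
    refine lt_of_mul_lt_mul_right (lt_of_le_of_lt ?_ hineq) (Nat.zero_le _)
    rw [mul_comm]
    exact key

theorem stmt1 {F V : Type*} [Field F] [Fintype F] [AddCommGroup V] [Module F V]
    [FiniteDimensional F V] {q m n : ℕ} (hq : Fintype.card F = q)
    (hqm : m ≤ q) (hm : 2 ≤ m) (hn : 2 * m - 1 ≤ n) (hV : finrank F V = n)
    (ℱ : Set (Submodule F V)) (hdim : ∀ A ∈ ℱ, finrank F ↥A = m)
    (hint : IsIntersectingFamily ℱ) (hτ : coveringNumber ℱ = m) :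
    (ℱ.ncard : ℚ) = gaussBinom q (2 * m - 1) m ↔
      ∃ X : Submodule F V, finrank F ↥X = 2 * m - 1 ∧
        ℱ = {G : Submodule F V | finrank F ↥G = m ∧ G ≤ X} := by
  have : Finite V := Module.finite_of_finite F
  subst hq hV
  constructor
  · intro hcard
    have hcov : ∀ W : Submodule F V, finrank F W < m → ∃ A ∈ ℱ, W ⊓ A = ⊥ := by
      intro W hW
      by_contra! h
      rw [← hτ] at hW
      exact Nat.notMem_of_lt_sInf hW
        ⟨W, rfl, fun A hA => Submodule.one_le_finrank_iff.2 (h A hA)⟩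
    obtain ⟨Y, hY, hle⟩ := forall_le_or_ncard_lt hqm hm hn hdim hint hcov
    have hG := ncard_eq_gaussBinom (m := m) Y (by omega)
    rw [hY, ← hcard, Nat.cast_inj] at hG
    refine ⟨Y, hY, ?_⟩
    rcases hle with hle | hlt
    · exact Set.eq_of_subset_of_ncard_le (fun G hG => ⟨hdim G hG, hle G hG⟩) hG.le
        (Set.toFinite _)
    · omega
  · rintro ⟨X, hX, rfl⟩
    rw [ncard_eq_gaussBinom X (by omega), hX]
end

section
/- Let n > 0 and l ≥ 0 be integers, V an (n+l)-dimensional vector space over 𝔽_q, and W₁ a fixed l-dimensional subspace of V. Let m ≥ 2, 0 ≤ k ≤ min{m, l}, m − k ≤ n, and let ℱ be a nonempty intersecting family of subspaces of type (m,k) with covering number τ(ℱ) = m. Suppose X = Σ_{F ∈ ℱ} F has dim(X) = 2m − 1. Then |ℱ| ≤ N(m,k;2m−1,t;n+l,n), where t = max{0, 2m−1−n} if k = 0 and t = m+k−1 if k ≥ 1; and equality holds if and only if X is of type (2m−1,t) and ℱ is the family of all subspaces of type (m,k) contained in X. -/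
open Module

/-- The tuples in `P` whose images under `g` are linearly independent. -/
def indepTuples {F V Q : Type*} [Field F] [AddCommGroup V] [Module F V] [AddCommGroup Q]
    [Module F Q] (g : V →ₗ[F] Q) (P : Submodule F V) (a : ℕ) : Set (Fin a → V) :=
  {w | (∀ i, w i ∈ P) ∧ LinearIndependent F (g ∘ w)}

theorem ncard_indepTuples {F V Q : Type*} [Field F] [Fintype F] [AddCommGroup V] [Module F V]
    [FiniteDimensional F V] [AddCommGroup Q] [Module F Q] (g : V →ₗ[F] Q) (P : Submodule F V)
    {a r d : ℕ} (hd : finrank F ↥(P ⊓ LinearMap.ker g) = d) (hr : finrank F P = d + r)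
    (ha : a ≤ r) :
    (indepTuples g P a).ncard =
      (Fintype.card F ^ d) ^ a *
        ∏ i ∈ Finset.range a, (Fintype.card F ^ r - Fintype.card F ^ i) := by
  classical
  have : Finite V := Module.finite_of_finite F
  let h : P →ₗ[F] Q := g.comp P.subtype
  obtain ⟨K, hK⟩ := Submodule.exists_isCompl (LinearMap.ker h)
  have hker : finrank F (LinearMap.ker h) = d := by
    have h1 : (LinearMap.ker h).map P.subtype = P ⊓ LinearMap.ker g := by
      rw [LinearMap.ker_comp, Submodule.map_comap_subtype]
    rw [← hd, ← h1]
    exact (Submodule.finrank_map_subtype_eq P _).symm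
  have hKr : finrank F K = r := by
    have := Submodule.finrank_add_eq_of_isCompl hK
    omega
  have hinj : LinearMap.ker (h.comp K.subtype) = ⊥ := by
    rw [LinearMap.ker_comp, ← Submodule.disjoint_iff_comap_eq_bot]
    exact hK.symm.disjoint
  let e := Submodule.prodEquivOfIsCompl _ _ hK
  have he : ∀ x, h (e x) = h x.2 := by
    intro x
    have : e x = (x.1 : P) + (x.2 : P) := Submodule.coe_prodEquivOfIsCompl' _ _ hK x
    rw [this, map_add, LinearMap.mem_ker.mp x.1.2, zero_add]
  let E : (Fin a → LinearMap.ker h) × {y : Fin a → K // LinearIndependent F y} ≃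
      indepTuples g P a :=
    { toFun := fun p => ⟨fun i => (e (p.1 i, p.2.1 i) : P), fun i => (e _).2, by
        have h1 : g ∘ (fun i => ((e (p.1 i, p.2.1 i) : P) : V)) = (h.comp K.subtype) ∘ p.2.1 := by
          funext i
          exact he _
        rw [h1]
        exact p.2.2.map' _ hinj⟩
      invFun := fun w => (fun i => (e.symm ⟨w.1 i, w.2.1 i⟩).1,
        ⟨fun i => (e.symm ⟨w.1 i, w.2.1 i⟩).2, by
          have h1 : (h.comp K.subtype) ∘ (fun i => (e.symm ⟨w.1 i, w.2.1 i⟩).2) = g ∘ w.1 := by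
            funext i
            have := he (e.symm ⟨w.1 i, w.2.1 i⟩)
            rw [LinearEquiv.apply_symm_apply] at this
            exact this.symm
          refine LinearIndependent.of_comp (h.comp K.subtype) ?_
          rw [h1]
          exact w.2.2⟩)
      left_inv := fun p => by simp
      right_inv := fun w => by simp }
  rw [← Nat.card_coe_set_eq, ← Nat.card_congr E, Nat.card_prod,
    card_linearIndependent (hKr.symm ▸ ha), Nat.card_fun, Nat.card_eq_fintype_card (α := Fin a),
    Fintype.card_fin, hKr, Module.natCard_eq_pow_finrank (K := F), hker, Nat.card_eq_fintype_card,
    Finset.prod_range fun i => Fintype.card F ^ r - Fintype.card F ^ i]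

/-- Pairs consisting of an independent tuple in `P ⊓ W` and a tuple in `P` that is independent
modulo `W`. -/
def adaptedTuples {F V : Type*} [Field F] [AddCommGroup V] [Module F V] (W : Submodule F V)
    (k a : ℕ) (P : Submodule F V) : Set ((Fin k → V) × (Fin a → V)) :=
  indepTuples LinearMap.id (P ⊓ W) k ×ˢ indepTuples W.mkQ P a

/-- The number of adapted tuples in a subspace of dimension `s + r` meeting `W` in dimension `s`. -/
def adaptedCount (q k a s r : ℕ) : ℕ :=
  (∏ i ∈ Finset.range k, (q ^ s - q ^ i)) *
    ((q ^ s) ^ a * ∏ i ∈ Finset.range a, (q ^ r - q ^ i))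

theorem ncard_adaptedTuples {F V : Type*} [Field F] [Fintype F] [AddCommGroup V] [Module F V]
    [FiniteDimensional F V] (W P : Submodule F V) {k a s r : ℕ}
    (hs : finrank F ↥(P ⊓ W) = s) (hr : finrank F P = s + r) (hk : k ≤ s) (ha : a ≤ r) :
    (adaptedTuples W k a P).ncard = adaptedCount (Fintype.card F) k a s r := by
  rw [adaptedTuples, Set.ncard_prod,
    ncard_indepTuples (d := 0) (r := s) LinearMap.id (P ⊓ W)
      (by rw [LinearMap.ker_id, inf_bot_eq, finrank_bot]) (by rwa [zero_add]) hk,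
    ncard_indepTuples W.mkQ P (by rwa [Submodule.ker_mkQ]) hr ha, adaptedCount]
  simp

theorem adaptedTuples_mono {F V : Type*} [Field F] [AddCommGroup V] [Module F V]
    (W : Submodule F V) (k a : ℕ) : Monotone (adaptedTuples W k a) := fun _ _ h _ hp =>
  ⟨⟨fun i => ⟨h (hp.1.1 i).1, (hp.1.1 i).2⟩, hp.1.2⟩, ⟨fun i => h (hp.2.1 i), hp.2.2⟩⟩

/-- The subspace spanned by a pair of tuples. -/
def pairSpan {F V : Type*} [Field F] [AddCommGroup V] [Module F V] {k a : ℕ}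
    (p : (Fin k → V) × (Fin a → V)) : Submodule F V :=
  Submodule.span F (Set.range p.1) ⊔ Submodule.span F (Set.range p.2)

section

variable {F V : Type*} [Field F] [AddCommGroup V] [Module F V] {W P : Submodule F V} {k a : ℕ}
  {p : (Fin k → V) × (Fin a → V)}

theorem pairSpan_le (hp : p ∈ adaptedTuples W k a P) : pairSpan p ≤ P := by
  refine sup_le (Submodule.span_le.mpr ?_) (Submodule.span_le.mpr ?_)
  · rintro _ ⟨i, rfl⟩
    exact (hp.1.1 i).1
  · rintro _ ⟨i, rfl⟩
    exact hp.2.1 i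

theorem mem_adaptedTuples_pairSpan (hp : p ∈ adaptedTuples W k a P) :
    p ∈ adaptedTuples W k a (pairSpan p) := by
  refine ⟨⟨fun i => ⟨?_, (hp.1.1 i).2⟩, hp.1.2⟩, ⟨fun i => ?_, hp.2.2⟩⟩
  · exact Submodule.mem_sup_left (Submodule.subset_span ⟨i, rfl⟩)
  · exact Submodule.mem_sup_right (Submodule.subset_span ⟨i, rfl⟩)

theorem pairSpan_inf (hp : p ∈ adaptedTuples W k a P) :
    pairSpan p ⊓ W = Submodule.span F (Set.range p.1) := by
  have h1 : Submodule.span F (Set.range p.1) ≤ W := by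
    rw [Submodule.span_le]
    rintro _ ⟨i, rfl⟩
    exact (hp.1.1 i).2
  have h2 := Submodule.range_ker_disjoint hp.2.2
  rw [Submodule.ker_mkQ] at h2
  rw [pairSpan, sup_inf_assoc_of_le _ h1, h2.eq_bot, sup_bot_eq]

theorem finrank_pairSpan_inf (hp : p ∈ adaptedTuples W k a P) :
    finrank F ↥(pairSpan p ⊓ W) = k := by
  rw [pairSpan_inf hp, finrank_span_eq_card (b := p.1) hp.1.2, Fintype.card_fin]

theorem finrank_pairSpan [FiniteDimensional F V] (hp : p ∈ adaptedTuples W k a P) :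
    finrank F ↥(pairSpan p : Submodule F V) = k + a := by
  have h1 : Submodule.span F (Set.range p.1) ≤ W := by
    rw [Submodule.span_le]
    rintro _ ⟨i, rfl⟩
    exact (hp.1.1 i).2
  have h2 := Submodule.range_ker_disjoint hp.2.2
  rw [Submodule.ker_mkQ] at h2
  have h3 := Submodule.finrank_sup_add_finrank_inf_eq
    (Submodule.span F (Set.range p.1)) (Submodule.span F (Set.range p.2))
  rw [(h2.symm.mono_left h1).eq_bot, finrank_bot, add_zero, finrank_span_eq_card (b := p.1) hp.1.2,
    finrank_span_eq_card (hp.2.2.of_comp), Fintype.card_fin, Fintype.card_fin] at h3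
  exact h3

end

/-- Double counting of adapted tuples: subspaces of type `(k + a, k)` in a subspace of type
`(s + r, s)`. -/
theorem ncard_type_mul {F V : Type*} [Field F] [Fintype F] [AddCommGroup V] [Module F V]
    [FiniteDimensional F V] (W P : Submodule F V) {k a s r : ℕ}
    (hs : finrank F ↥(P ⊓ W) = s) (hr : finrank F P = s + r) (hk : k ≤ s) (ha : a ≤ r) :
    {S : Submodule F V | S ≤ P ∧ finrank F ↥S = k + a ∧ finrank F ↥(S ⊓ W) = k}.ncard *
      adaptedCount (Fintype.card F) k a k a = adaptedCount (Fintype.card F) k a s r := by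
  classical
  have : Finite V := Module.finite_of_finite F
  have : Finite (Submodule F V) := Finite.of_injective _ SetLike.coe_injective
  set 𝒮 := {S : Submodule F V | S ≤ P ∧ finrank F ↥S = k + a ∧ finrank F ↥(S ⊓ W) = k} with h𝒮
  have hf𝒮 := Set.toFinite 𝒮
  have hfT := Set.toFinite (adaptedTuples W k a P)
  rw [← ncard_adaptedTuples W P hs hr hk ha, Set.ncard_eq_toFinset_card _ hf𝒮,
    Set.ncard_eq_toFinset_card _ hfT,
    Finset.card_eq_sum_card_fiberwise (f := pairSpan) (t := hf𝒮.toFinset)]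
  · symm
    refine Finset.sum_const_nat fun S hS => ?_
    rw [Set.Finite.mem_toFinset] at hS
    rw [← ncard_adaptedTuples W S hS.2.2 hS.2.1 le_rfl le_rfl, ← Set.ncard_coe_finset]
    congr 1
    ext p
    simp only [Finset.coe_filter, Set.Finite.mem_toFinset, Set.mem_ofPred_eq]
    constructor
    · rintro ⟨hp, rfl⟩
      exact mem_adaptedTuples_pairSpan hp
    · intro hp
      refine ⟨adaptedTuples_mono W k a hS.1 hp, ?_⟩
      exact Submodule.eq_of_le_of_finrank_eq (pairSpan_le hp)
        ((finrank_pairSpan hp).trans hS.2.1.symm)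
  · intro p hp
    rw [Finset.mem_coe, Set.Finite.mem_toFinset] at hp ⊢
    exact ⟨pairSpan_le hp, finrank_pairSpan hp, finrank_pairSpan_inf hp⟩

theorem adaptedCount_pos {q k a s r : ℕ} (hq : 2 ≤ q) (hk : k ≤ s) (ha : a ≤ r) :
    0 < adaptedCount q k a s r := by
  have key : ∀ {b c : ℕ}, b ≤ c → 0 < ∏ i ∈ Finset.range b, (q ^ c - q ^ i) := fun {b c} h =>
    Finset.prod_pos fun i hi => Nat.sub_pos_of_lt
      (Nat.pow_lt_pow_right hq ((Finset.mem_range.mp hi).trans_le h))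
  exact Nat.mul_pos (key hk) (Nat.mul_pos (by positivity) (key ha))

theorem cast_prod_pow_sub {q b c : ℕ} (hq : 2 ≤ q) (h : b ≤ c) :
    ((∏ i ∈ Finset.range b, (q ^ c - q ^ i) : ℕ) : ℝ) =
      ∏ i ∈ Finset.range b, ((q : ℝ) ^ c - (q : ℝ) ^ i) := by
  rw [Nat.cast_prod]
  refine Finset.prod_congr rfl fun i hi => ?_
  rw [Nat.cast_sub (Nat.pow_le_pow_right (by omega) ((Finset.mem_range.mp hi).le.trans h))]
  push_cast
  rfl

theorem prod_pow_succ_sub_mul (x : ℝ) (k s : ℕ) :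
    (∏ i ∈ Finset.range k, (x ^ (s + 1) - x ^ i)) * (x ^ (s + 1) - x ^ k) =
      (x ^ (s + 1) - 1) * x ^ k * ∏ i ∈ Finset.range k, (x ^ s - x ^ i) := by
  rw [← Finset.prod_range_succ, Finset.prod_range_succ',
    Finset.prod_congr rfl (g := fun i => x * (x ^ s - x ^ i)) (fun i _ => by ring),
    Finset.prod_mul_distrib, Finset.prod_const, Finset.card_range]
  ring

/-- The ratio of consecutive counts. -/
theorem adaptedCount_succ_mul {q : ℕ} (hq : 2 ≤ q) (k a d e : ℕ) :
    (adaptedCount q k a (k + d + 1) (a + e) : ℝ) *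
        (((q : ℝ) ^ (d + 1) - 1) * ((q : ℝ) ^ (a + e + 1) - 1)) =
      adaptedCount q k a (k + d) (a + e + 1) *
        ((q : ℝ) ^ a * ((q : ℝ) ^ (k + d + 1) - 1) * ((q : ℝ) ^ (e + 1) - 1)) := by
  have hq0 : (q : ℝ) ≠ 0 := by
    have : q ≠ 0 := by omega
    exact_mod_cast this
  have h1 := prod_pow_succ_sub_mul q k (k + d)
  have h2 := prod_pow_succ_sub_mul q a (a + e)
  simp only [adaptedCount, Nat.cast_mul]
  rw [cast_prod_pow_sub hq (show k ≤ k + d + 1 by omega),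
    cast_prod_pow_sub hq (Nat.le_add_right k d),
    cast_prod_pow_sub hq (Nat.le_add_right a e), cast_prod_pow_sub hq (show a ≤ a + e + 1 by omega)]
  generalize ∏ i ∈ Finset.range k, ((q : ℝ) ^ (k + d + 1) - (q : ℝ) ^ i) = B₁ at *
  generalize ∏ i ∈ Finset.range k, ((q : ℝ) ^ (k + d) - (q : ℝ) ^ i) = B₀ at *
  generalize ∏ i ∈ Finset.range a, ((q : ℝ) ^ (a + e + 1) - (q : ℝ) ^ i) = C₁ at *
  generalize ∏ i ∈ Finset.range a, ((q : ℝ) ^ (a + e) - (q : ℝ) ^ i) = C₀ at *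
  have h1' : B₁ * ((q : ℝ) ^ (d + 1) - 1) = ((q : ℝ) ^ (k + d + 1) - 1) * B₀ := by
    apply mul_left_cancel₀ (pow_ne_zero k hq0)
    linear_combination h1
  have h2' : C₁ * ((q : ℝ) ^ (e + 1) - 1) = ((q : ℝ) ^ (a + e + 1) - 1) * C₀ := by
    apply mul_left_cancel₀ (pow_ne_zero a hq0)
    linear_combination h2
  push_cast
  have h3 : ((q : ℝ) ^ (k + d + 1)) ^ a = ((q : ℝ) ^ (k + d)) ^ a * (q : ℝ) ^ a := by ring
  rw [h3]
  generalize ((q : ℝ) ^ (k + d)) ^ a = Z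
  linear_combination Z * (q : ℝ) ^ a * C₀ * ((q : ℝ) ^ (a + e + 1) - 1) * h1' -
    Z * (q : ℝ) ^ a * ((q : ℝ) ^ (k + d + 1) - 1) * B₀ * h2'

theorem two_le_pow_cast {q b : ℕ} (hq : 2 ≤ q) (hb : 1 ≤ b) : (2 : ℝ) ≤ (q : ℝ) ^ b := by
  have : 2 ≤ q ^ b := hq.trans (Nat.le_self_pow (by omega) q)
  exact_mod_cast this

theorem adaptedCount_lt_succ {q k : ℕ} (hq : 2 ≤ q) (hk : 1 ≤ k) (a d e : ℕ) :
    adaptedCount q k a (k + d) (a + e + 1) < adaptedCount q k a (k + d + 1) (a + e) := by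
  have hpos : (0 : ℝ) < adaptedCount q k a (k + d) (a + e + 1) := by
    exact_mod_cast adaptedCount_pos hq (Nat.le_add_right k d) (show a ≤ a + e + 1 by omega)
  have h := adaptedCount_succ_mul hq k a d e
  have hK := two_le_pow_cast hq hk
  have hD := two_le_pow_cast hq (show 1 ≤ d + 1 by omega)
  have hE := two_le_pow_cast hq (show 1 ≤ e + 1 by omega)
  have hA : (1 : ℝ) ≤ (q : ℝ) ^ a := one_le_pow₀ (by exact_mod_cast (by omega : 1 ≤ q))
  rw [show k + d + 1 = k + (d + 1) by omega, show a + e + 1 = a + (e + 1) by omega,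
    pow_add _ k, pow_add _ a] at h
  rw [← Nat.cast_lt (α := ℝ)]
  rw [show k + d + 1 = k + (d + 1) by omega, show a + e + 1 = a + (e + 1) by omega] at *
  generalize (q : ℝ) ^ k = K at *
  generalize (q : ℝ) ^ a = A at *
  generalize (q : ℝ) ^ (d + 1) = D at *
  generalize (q : ℝ) ^ (e + 1) = E at *
  have hAE : 0 < A * E - 1 := by nlinarith
  have hc : 0 < (D - 1) * (A * E - 1) := mul_pos (by linarith) hAE
  have hlt : (D - 1) * (A * E - 1) < A * (K * D - 1) * (E - 1) := by
    have h1 : 0 ≤ A * D * ((K - 1) * (E - 1) - 1) :=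
      mul_nonneg (by nlinarith) (by nlinarith)
    nlinarith
  refine lt_of_mul_lt_mul_right ?_ hc.le
  rw [h]
  exact mul_lt_mul_of_pos_left hlt hpos

theorem adaptedCount_succ_lt {q a : ℕ} (hq : 2 ≤ q) (ha : 1 ≤ a) (d e : ℕ) :
    adaptedCount q 0 a (d + 1) (a + e) < adaptedCount q 0 a d (a + e + 1) := by
  have hpos : (0 : ℝ) < adaptedCount q 0 a d (a + e + 1) := by
    exact_mod_cast adaptedCount_pos hq (Nat.zero_le d) (show a ≤ a + e + 1 by omega)
  have h := adaptedCount_succ_mul hq 0 a d e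
  have hA := two_le_pow_cast hq ha
  have hD := two_le_pow_cast hq (show 1 ≤ d + 1 by omega)
  have hE := two_le_pow_cast hq (show 1 ≤ e + 1 by omega)
  rw [zero_add, show a + e + 1 = a + (e + 1) by omega, pow_add _ a] at h
  rw [← Nat.cast_lt (α := ℝ)]
  rw [show a + e + 1 = a + (e + 1) by omega] at *
  generalize (q : ℝ) ^ a = A at *
  generalize (q : ℝ) ^ (d + 1) = D at *
  generalize (q : ℝ) ^ (e + 1) = E at *
  have hAE : 0 < A * E - 1 := by nlinarith
  have hc : 0 < (D - 1) * (A * E - 1) := mul_pos (by linarith) hAE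
  have hlt : A * (D - 1) * (E - 1) < (D - 1) * (A * E - 1) := by
    nlinarith [mul_pos (show 0 < D - 1 by linarith) (show 0 < A - 1 by linarith)]
  refine lt_of_mul_lt_mul_right ?_ hc.le
  rw [h]
  exact mul_lt_mul_of_pos_left hlt hpos

theorem adaptedCount_lt_top {q k : ℕ} (hq : 2 ≤ q) (hk : 1 ≤ k) (a : ℕ) :
    ∀ e d : ℕ, adaptedCount q k a (k + d) (a + e + 1) < adaptedCount q k a (k + d + e + 1) a
  | 0, d => adaptedCount_lt_succ hq hk a d 0
  | e + 1, d => by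
    refine (adaptedCount_lt_succ hq hk a d (e + 1)).trans ?_
    have := adaptedCount_lt_top hq hk a e (d + 1)
    rwa [show k + (d + 1) + e + 1 = k + d + (e + 1) + 1 by omega] at this

theorem adaptedCount_zero_lt {q a : ℕ} (hq : 2 ≤ q) (ha : 1 ≤ a) (e t : ℕ) :
    ∀ d : ℕ, adaptedCount q 0 a (t + d + 1) (a + e) < adaptedCount q 0 a t (a + e + d + 1)
  | 0 => adaptedCount_succ_lt hq ha t e
  | d + 1 => by
    refine (adaptedCount_succ_lt hq ha (t + (d + 1)) e).trans ?_
    have := adaptedCount_zero_lt hq ha (e + 1) t d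
    rwa [show a + (e + 1) + d + 1 = a + e + (d + 1) + 1 by omega] at this

theorem stmt17 {F V : Type*} [Field F] [Fintype F] [AddCommGroup V] [Module F V]
    [FiniteDimensional F V] {n l m k t : ℕ}
    (hn : 0 < n) (hV : finrank F V = n + l)
    (W₁ : Submodule F V) (hW₁ : finrank F ↥W₁ = l)
    (hm : 2 ≤ m) (hk : k ≤ min m l) (hmk : m - k ≤ n)
    (ℱ : Set (Submodule F V)) (hne : ℱ.Nonempty)
    (hmem : ∀ A ∈ ℱ, finrank F ↥A = m ∧ finrank F ↥(A ⊓ W₁) = k)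
    (hint : IsIntersectingFamily ℱ) (hτ : coveringNumber ℱ = m)
    (hX : finrank F ↥(sSup ℱ) = 2 * m - 1)
    (ht : t = if k = 0 then 2 * m - 1 - n else m + k - 1) :
    ∀ P : Submodule F V, finrank F ↥P = 2 * m - 1 → finrank F ↥(P ⊓ W₁) = t →
      ℱ.ncard ≤ {S : Submodule F V | S ≤ P ∧ finrank F ↥S = m ∧
          finrank F ↥(S ⊓ W₁) = k}.ncard ∧
        (ℱ.ncard = {S : Submodule F V | S ≤ P ∧ finrank F ↥S = m ∧
            finrank F ↥(S ⊓ W₁) = k}.ncard ↔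
          (finrank F ↥(sSup ℱ ⊓ W₁) = t ∧
            ℱ = {S : Submodule F V | S ≤ sSup ℱ ∧ finrank F ↥S = m ∧
              finrank F ↥(S ⊓ W₁) = k})) := by
  classical
  intro P hP hPt
  have : Finite V := Module.finite_of_finite F
  have : Finite (Submodule F V) := Finite.of_injective _ SetLike.coe_injective
  have hq : 2 ≤ Fintype.card F := Fintype.one_lt_card
  obtain ⟨hkm, hkl⟩ := le_min_iff.mp hk
  obtain ⟨a, rfl⟩ := Nat.exists_eq_add_of_le hkm
  set X := sSup ℱ with hXdef
  obtain ⟨s, hs⟩ : ∃ s, finrank F ↥(X ⊓ W₁) = s := ⟨_, rfl⟩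
  obtain ⟨A, hA⟩ := hne
  have hAX : A ≤ X := le_sSup hA
  obtain ⟨hAm, hAk⟩ := hmem A hA
  have hks : k ≤ s := by
    rw [← hAk, ← hs]
    exact Submodule.finrank_mono (inf_le_inf_right _ hAX)
  have hsk : s ≤ k + a + k - 1 := by
    have h1 := Submodule.finrank_sup_add_finrank_inf_eq A (X ⊓ W₁)
    rw [← inf_assoc, inf_eq_left.mpr hAX, hAm, hAk, hs] at h1
    have h2 := Submodule.finrank_mono (sup_le hAX (inf_le_left : X ⊓ W₁ ≤ X))
    omega
  have hsn : 2 * (k + a) - 1 ≤ n + s := by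
    have h1 := Submodule.finrank_sup_add_finrank_inf_eq X W₁
    have h2 := Submodule.finrank_le (X ⊔ W₁)
    omega
  have hcX := ncard_type_mul W₁ X (k := k) (a := a) (r := 2 * (k + a) - 1 - s) hs
    (by omega) hks (by omega)
  have hkt : k ≤ t := by split_ifs at ht <;> omega
  have hcP := ncard_type_mul W₁ P (k := k) (a := a) (r := 2 * (k + a) - 1 - t) hPt
    (by split_ifs at ht <;> omega) hkt (by split_ifs at ht <;> omega)
  have hC := adaptedCount_pos hq (le_refl k) (le_refl a)
  set 𝒮 := {S : Submodule F V | S ≤ X ∧ finrank F ↥S = k + a ∧ finrank F ↥(S ⊓ W₁) = k}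
  have hsub : ℱ ⊆ 𝒮 := fun S hS => ⟨le_sSup hS, hmem S hS⟩
  have hle : ℱ.ncard ≤ 𝒮.ncard := Set.ncard_le_ncard hsub
  by_cases hst : s = t
  · subst hst
    have hXP := Nat.eq_of_mul_eq_mul_right hC (hcX.trans hcP.symm)
    rw [← hXP]
    refine ⟨hle, fun h => ⟨hs, Set.eq_of_subset_of_ncard_le hsub h.ge⟩, fun h => ?_⟩
    exact congrArg Set.ncard h.2
  · have hlt : 𝒮.ncard < {S : Submodule F V | S ≤ P ∧ finrank F ↥S = k + a ∧
        finrank F ↥(S ⊓ W₁) = k}.ncard := by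
      refine lt_of_mul_lt_mul_right ?_ hC.le
      rw [hcX, hcP]
      split_ifs at ht with hk0
      · subst hk0
        obtain ⟨d, rfl⟩ := Nat.exists_eq_add_of_lt (show t < s by omega)
        have := adaptedCount_zero_lt hq (show 1 ≤ a by omega) (a - 1 - (t + d + 1)) t d
        rwa [show a + (a - 1 - (t + d + 1)) = 2 * (0 + a) - 1 - (t + d + 1) by omega,
          show 2 * (0 + a) - 1 - (t + d + 1) + d + 1 = 2 * (0 + a) - 1 - t by omega] at this
      · obtain ⟨d, rfl⟩ := Nat.exists_eq_add_of_le hks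
        rw [show 2 * (k + a) - 1 - t = a by omega]
        have := adaptedCount_lt_top hq (show 1 ≤ k by omega) a (k + a + k - 1 - (k + d) - 1) d
        rwa [show a + (k + a + k - 1 - (k + d) - 1) + 1 = 2 * (k + a) - 1 - (k + d) by omega,
          show k + d + (k + a + k - 1 - (k + d) - 1) + 1 = t by omega] at this
    refine ⟨(hle.trans_lt hlt).le, fun h => absurd h (hle.trans_lt hlt).ne, fun h => ?_⟩
    exact absurd (hs.symm.trans h.1) hst
end
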